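/- Let Γ be a connected finite multigraph with more than two vertices in which every vertex has degree 1 or 3. Suppose v₁, v₂ are distinct vertices and e, e₁, e₂ are distinct edges such that: ends(e) = {v₁, v₂}; ends(e₁) = {v₂, a} and ends(e₂) = {v₂, b} with a ≠ v₂ and b ≠ v₂ (possibly a = b); v₁ has degree 1; and v₂ has degree 3. Let Γ' be the multigraph with vertex set V ∖ {v₁, v₂} and edge set (E ∖ {e, e₁, e₂}) ∪ {f}, where f is a new edge with ends(f) = {a, b}. Then Γ' is connected, every vertex of Γ' has degree 1 or 3 (each vertex of Γ' has the same degree in Γ' as in Γ), and χ(Γ') = χ(Γ). -/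

import Mathlib

/-- A finite multigraph on a vertex type `V` with edge type `E`: each edge is assigned an
unordered pair of endpoints (loops allowed). -/
structure Multigraph (V : Type*) (E : Type*) where
  ends : E → Sym2 V

namespace Multigraph

variable {V E : Type*}

/-- The degree of a vertex: number of edge-incidences at `v`, a loop counted twice. -/
def degree [Fintype E] [DecidableEq V] (G : Multigraph V E) (v : V) : ℕ :=
  ∑ e : E, (if v ∈ G.ends e then (if (G.ends e).IsDiag then 2 else 1) else 0)

/-- Adjacency using only edges from the set `T`. -/
def adjOn (G : Multigraph V E) (T : Set E) : V → V → Prop :=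
  fun v w => ∃ e ∈ T, G.ends e = s(v, w)

/-- Adjacency in `G`: some edge has endpoints `v` and `w`. -/
def adj (G : Multigraph V E) : V → V → Prop := G.adjOn Set.univ

/-- `G` is connected: `V` is nonempty and any two vertices are joined by a walk. -/
def Connected (G : Multigraph V E) : Prop :=
  Nonempty V ∧ ∀ v w : V, Relation.ReflTransGen G.adj v w

/-- The subgraph of `G` with vertex set `S` and edge set `T` is a tree: the edges of `T`
join vertices of `S`, it is connected, and it contains no cycle (no edge of `T` has its
endpoints joined by a walk avoiding that edge; in particular there are no loops and no
parallel edges). -/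
def IsTreeOn (G : Multigraph V E) (S : Set V) (T : Set E) : Prop :=
  (∀ e ∈ T, ∀ a ∈ G.ends e, a ∈ S) ∧
  S.Nonempty ∧
  (∀ v ∈ S, ∀ w ∈ S, Relation.ReflTransGen (G.adjOn T) v w) ∧
  (∀ e ∈ T, ∀ a b : V, G.ends e = s(a, b) →
    ¬ Relation.ReflTransGen (G.adjOn (T \ {e})) a b)

/-- The connected component containing `u` of the graph obtained from `G` by deleting
the vertex `v` together with all edges incident to `v`. -/
def compAway (G : Multigraph V E) (v u : V) : Set V :=
  {w | w ≠ v ∧ Relation.ReflTransGen (G.adjOn {e | v ∉ G.ends e}) u w}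

/-- The edge set of the subgraph associated with `v` and the component of `u` in
`G ∖ {v}`: all non-loop edges of `G` having both endpoints in the component of `u`
together with `v`. -/
def assocEdges (G : Multigraph V E) (v u : V) : Set E :=
  {e | ¬ (G.ends e).IsDiag ∧ ∀ a ∈ G.ends e, a ∈ G.compAway v u ∪ {v}}

/-- A vertex `v` is essential: its degree is at least `2`, none of the loop subgraphs at
`v` is a tree, and none of the subgraphs associated with `v` coming from connected
components of `G ∖ {v}` is a tree. -/
def Essential [Fintype E] [DecidableEq V] (G : Multigraph V E) (v : V) : Prop :=
  2 ≤ G.degree v ∧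
  (∀ e : E, G.ends e = s(v, v) → ¬ G.IsTreeOn {v} {e}) ∧
  (∀ u : V, u ≠ v → ¬ G.IsTreeOn (G.compAway v u ∪ {v}) (G.assocEdges v u))

end Multigraph

theorem Fintype.sum_eq_add_add_add_sum_subtype {α M : Type*} [Fintype α] [DecidableEq α]
    [AddCommMonoid M] (f : α → M) {x y z : α} (hxy : x ≠ y) (hxz : x ≠ z) (hyz : y ≠ z) :
    ∑ i, f i = f x + f y + f z + ∑ i : {i : α // i ≠ x ∧ i ≠ y ∧ i ≠ z}, f i := by
  rw [← Finset.add_sum_erase _ f (Finset.mem_univ x),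
    ← Finset.add_sum_erase _ f (a := y) (by simp [hxy.symm]),
    ← Finset.add_sum_erase _ f (a := z) (by simp [hxz.symm, hyz.symm]),
    Finset.sum_subtype (p := fun i => i ≠ x ∧ i ≠ y ∧ i ≠ z) _ (by intro i; simp; tauto),
    add_assoc, add_assoc]

theorem Fintype.card_subtype_ne_and_ne {α : Type*} [Fintype α] [DecidableEq α] {x y : α}
    (hxy : x ≠ y) : Fintype.card {i : α // i ≠ x ∧ i ≠ y} + 2 = Fintype.card α := by
  have h := Fintype.card_subtype_compl (fun i : α => i = x ∨ i = y)
  have hle := Fintype.card_subtype_le (fun i : α => i = x ∨ i = y)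
  have h₂ : Fintype.card {i : α // i = x ∨ i = y} = 2 := by
    rw [Fintype.card_subtype, ← Finset.card_pair hxy]
    congr 1
    ext i
    simp
  simp only [not_or] at h
  simp only [ne_eq]
  omega

namespace Multigraph

variable {V E : Type*}

/-- The number of times the edge `e` is incident to the vertex `v`. -/
def incidence [DecidableEq V] (G : Multigraph V E) (v : V) (e : E) : ℕ :=
  if v ∈ G.ends e then (if (G.ends e).IsDiag then 2 else 1) else 0

theorem degree_eq_sum_incidence [Fintype E] [DecidableEq V] (G : Multigraph V E) (v : V) :
    G.degree v = ∑ e, G.incidence v e := rfl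

theorem incidence_of_ends [DecidableEq V] {G : Multigraph V E} {e : E} {x y : V}
    (h : G.ends e = s(x, y)) (v : V) :
    G.incidence v e = (if v = x then 1 else 0) + (if v = y then 1 else 0) := by
  simp only [incidence, h, Sym2.mem_iff, Sym2.mk_isDiag_iff]
  grind

theorem incidence_eq_zero [DecidableEq V] {G : Multigraph V E} {v : V} {e : E} :
    G.incidence v e = 0 ↔ v ∉ G.ends e := by
  unfold incidence
  grind

theorem incidence_eq_of_map [DecidableEq V] {F : Type*} {p : V → Prop}
    {G : Multigraph V E} {H : Multigraph (Subtype p) F} {e : E} {f : F}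
    (h : Sym2.map Subtype.val (H.ends f) = G.ends e) (v : Subtype p) :
    H.incidence v f = G.incidence v.val e := by
  obtain ⟨x, y, hxy⟩ : ∃ x y, H.ends f = s(x, y) :=
    Sym2.ind (fun x y => ⟨x, y, rfl⟩) (H.ends f)
  rw [hxy, Sym2.map_mk] at h
  rw [incidence_of_ends hxy, incidence_of_ends h.symm]
  simp only [Subtype.ext_iff]

theorem adj_of_map_ends {F : Type*} {p : V → Prop} {H : Multigraph (Subtype p) F} {f : F}
    {x y : Subtype p} (h : Sym2.map Subtype.val (H.ends f) = s(x.val, y.val)) : H.adj x y :=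
  ⟨f, Set.mem_univ f, Sym2.map.injective Subtype.val_injective h⟩

/-- A graph is connected as soon as it receives a surjection from the vertices of a connected
graph which sends adjacent vertices to vertices joined by a walk. -/
theorem Connected.of_surjective {W F : Type*} {G : Multigraph V E} {H : Multigraph W F}
    (hG : G.Connected) (π : V → W) (hπ : Function.Surjective π)
    (hadj : ∀ x y, G.adj x y → Relation.ReflTransGen H.adj (π x) (π y)) : H.Connected := by
  refine ⟨hG.1.map π, fun v w => ?_⟩
  obtain ⟨x, rfl⟩ := hπ v
  obtain ⟨y, rfl⟩ := hπ w
  exact Relation.ReflTransGen.lift' π hadj _ _ (hG.2 x y)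

end Multigraph

open Multigraph in
/-- Let `Γ` be a connected finite multigraph with more than two
vertices in which every vertex has degree 1 or 3, with distinct vertices `v₁, v₂`,
distinct edges `e, e₁, e₂` such that `ends(e) = {v₁, v₂}`, `ends(e₁) = {v₂, a}`,
`ends(e₂) = {v₂, b}` with `a ≠ v₂`, `b ≠ v₂`, where `v₁` has degree 1 and `v₂` has
degree 3.  Let `Γ'` be the multigraph with vertex set `V ∖ {v₁, v₂}` and edge set
`(E ∖ {e, e₁, e₂}) ∪ {f}`, where `f` is a new edge with `ends(f) = {a, b}`.  Then `Γ'`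
is connected, each of its vertices has the same degree as in `Γ` (hence degree 1 or 3),
and `χ(Γ') = χ(Γ)`. -/
theorem multigraph_reduction_properties
    {V E : Type*} [Fintype V] [Fintype E] [DecidableEq V] [DecidableEq E]
    (G : Multigraph V E) (hconn : G.Connected) (hcard : 2 < Fintype.card V)
    (hdeg : ∀ v : V, G.degree v = 1 ∨ G.degree v = 3)
    (v₁ v₂ a b : V) (e e₁ e₂ : E)
    (hv : v₁ ≠ v₂) (hee₁ : e ≠ e₁) (hee₂ : e ≠ e₂) (he₁e₂ : e₁ ≠ e₂)
    (hends : G.ends e = s(v₁, v₂)) (hends₁ : G.ends e₁ = s(v₂, a))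
    (hends₂ : G.ends e₂ = s(v₂, b)) (ha : a ≠ v₂) (hb : b ≠ v₂)
    (hd₁ : G.degree v₁ = 1) (hd₂ : G.degree v₂ = 3)
    (G' : Multigraph {v : V // v ≠ v₁ ∧ v ≠ v₂}
      ({e' : E // e' ≠ e ∧ e' ≠ e₁ ∧ e' ≠ e₂} ⊕ Unit))
    (hG'old : ∀ e' : {e' : E // e' ≠ e ∧ e' ≠ e₁ ∧ e' ≠ e₂},
      Sym2.map Subtype.val (G'.ends (Sum.inl e')) = G.ends e'.val)
    (hG'new : ∀ u : Unit, Sym2.map Subtype.val (G'.ends (Sum.inr u)) = s(a, b)) :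
    G'.Connected ∧
    (∀ v : {v : V // v ≠ v₁ ∧ v ≠ v₂}, G'.degree v = G.degree v.val) ∧
    (∀ v : {v : V // v ≠ v₁ ∧ v ≠ v₂}, G'.degree v = 1 ∨ G'.degree v = 3) ∧
    (Fintype.card {v : V // v ≠ v₁ ∧ v ≠ v₂} : ℤ) -
        (Fintype.card ({e' : E // e' ≠ e ∧ e' ≠ e₁ ∧ e' ≠ e₂} ⊕ Unit) : ℤ) =
      (Fintype.card V : ℤ) - (Fintype.card E : ℤ) := by
  have hsplit (v : V) := G.degree_eq_sum_incidence v ▸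
    Fintype.sum_eq_add_add_add_sum_subtype (G.incidence v) hee₁ hee₂ he₁e₂
  have hav : a ≠ v₁ ∧ a ≠ v₂ := by
    obtain ⟨x, -, hx⟩ := Sym2.mem_map.1 (hG'new () ▸ Sym2.mem_mk_left a b)
    exact hx ▸ x.2
  have hbv : b ≠ v₁ ∧ b ≠ v₂ := by
    obtain ⟨x, -, hx⟩ := Sym2.mem_map.1 (hG'new () ▸ Sym2.mem_mk_right a b)
    exact hx ▸ x.2
  have hrest (v : V) (hv' : v = v₁ ∨ v = v₂) (e' : E) (h : e' ≠ e ∧ e' ≠ e₁ ∧ e' ≠ e₂) :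
      v ∉ G.ends e' := by
    have h0 : ∑ i : {i : E // i ≠ e ∧ i ≠ e₁ ∧ i ≠ e₂}, G.incidence v i = 0 := by
      have := hsplit v
      rw [incidence_of_ends hends, incidence_of_ends hends₁, incidence_of_ends hends₂] at this
      rcases hv' with rfl | rfl
      · rw [hd₁, if_pos rfl] at this
        omega
      · rw [hd₂, if_pos rfl] at this
        omega
    exact incidence_eq_zero.1 (Finset.sum_eq_zero_iff.1 h0 ⟨e', h⟩ (Finset.mem_univ _))
  have hdegree (v : {v : V // v ≠ v₁ ∧ v ≠ v₂}) : G'.degree v = G.degree v.val := by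
    have hnew : G'.incidence v (Sum.inr ()) =
        (if v.val = a then 1 else 0) + (if v.val = b then 1 else 0) := by
      have h : G'.ends (Sum.inr ()) = s(⟨a, hav⟩, ⟨b, hbv⟩) :=
        Sym2.map.injective Subtype.val_injective (hG'new ())
      rw [incidence_of_ends h]
      simp only [Subtype.ext_iff]
    rw [hsplit, incidence_of_ends hends, incidence_of_ends hends₁, incidence_of_ends hends₂,
      degree_eq_sum_incidence, Fintype.sum_sum_type]
    simp [hnew, incidence_eq_of_map (hG'old _), v.2.1, v.2.2, add_comm]
  refine ⟨?_, hdegree, fun v => hdegree v ▸ hdeg v, ?_⟩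
  · refine hconn.of_surjective (fun v => if h : v ≠ v₁ ∧ v ≠ v₂ then ⟨v, h⟩ else ⟨a, hav⟩)
      (fun v => ⟨v, dif_pos v.2⟩) ?_
    rintro x y ⟨e', -, he'⟩
    by_cases h : e' ≠ e ∧ e' ≠ e₁ ∧ e' ≠ e₂
    · have hmem {v : V} (hv' : v ∈ G.ends e') : v ≠ v₁ ∧ v ≠ v₂ :=
        ⟨fun h₁ => hrest v (.inl h₁) e' h hv', fun h₂ => hrest v (.inr h₂) e' h hv'⟩
      have hx := hmem (he' ▸ Sym2.mem_mk_left x y)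
      have hy := hmem (he' ▸ Sym2.mem_mk_right x y)
      rw [dif_pos hx, dif_pos hy]
      exact .single (adj_of_map_ends ((hG'old ⟨e', h⟩).trans he'))
    · have hab : G'.adj ⟨a, hav⟩ ⟨b, hbv⟩ := adj_of_map_ends (hG'new ())
      have hba : G'.adj ⟨b, hbv⟩ ⟨a, hav⟩ :=
        adj_of_map_ends ((hG'new ()).trans Sym2.eq_swap)
      obtain rfl | rfl | rfl : e' = e ∨ e' = e₁ ∨ e' = e₂ := by tauto
      · rw [hends, Sym2.eq_iff] at he'
        rcases he' with ⟨rfl, rfl⟩ | ⟨rfl, rfl⟩ <;> simp [Relation.ReflTransGen.refl]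
      · rw [hends₁, Sym2.eq_iff] at he'
        rcases he' with ⟨rfl, rfl⟩ | ⟨rfl, rfl⟩ <;> simp [hav, Relation.ReflTransGen.refl]
      · rw [hends₂, Sym2.eq_iff] at he'
        rcases he' with ⟨rfl, rfl⟩ | ⟨rfl, rfl⟩
        · simpa [hbv] using Relation.ReflTransGen.single hab
        · simpa [hbv] using Relation.ReflTransGen.single hba
  · have hV := Fintype.card_subtype_ne_and_ne hv
    have hE := Fintype.sum_eq_add_add_add_sum_subtype (fun _ : E => 1) hee₁ hee₂ he₁e₂
    simp only [Finset.sum_const, Finset.card_univ, smul_eq_mul, mul_one] at hE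
    rw [Fintype.card_sum, Fintype.card_unit]
    omega
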